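/- Let μ** be a Radon measure on E⊓ = [0,∞]×(0,∞] that is homogeneous of order −1 (μ**(cB) = c^{−1}μ**(B) for all c > 0 and Borel B ⊂ E⊓). Define the angular measure S on [0,1) by S(Λ) = μ**{(x,y) ∈ E⊓ : x+y > 1, x/(x+y) ∈ Λ}. Then for all r > 0 and Borel Λ ⊂ [0,1), μ**{(x,y) : x+y > r, x/(x+y) ∈ Λ} = r^{−1}S(Λ), and for all x > 0, y > 0, μ**([0,x]×(y,∞]) = y^{−1}∫₀^{x/(x+y)}(1−w) S(dw) − x^{−1}∫₀^{x/(x+y)} w S(dw). -/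

import Mathlib

open MeasureTheory Filter Topology Set
open scoped ENNReal NNReal

noncomputable section

abbrev Epts : Type := ℝ≥0∞ × ℝ≥0∞

/-- The cone `E⊓ = [0,∞] × (0,∞]`. -/
def Enb : Set Epts := Set.univ ×ˢ Set.Ioi 0

/-- The cone `E⊃ = (0,∞] × [0,∞]`. -/
def Enl : Set Epts := Set.Ioi 0 ×ˢ Set.univ

/-- The cone `E = [0,∞]² \ {(0,0)}`. -/
def Efull : Set Epts := {p | p ≠ (0, 0)}

/-- Vague convergence of `t ↦ t · P[(X/t, Y/t) ∈ ·]` to `μ` on the cone `C`: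
convergence on every Borel set that is relatively compact in `C` and whose
boundary is `μ`-null. -/
def VagueStd {Ω : Type*} [MeasurableSpace Ω] (P : Measure Ω) (X Y : Ω → ℝ)
    (C : Set Epts) (μ : Measure Epts) : Prop :=
  ∀ S : Set Epts, MeasurableSet S → closure S ⊆ C → μ (frontier S) = 0 →
    Tendsto
      (fun t : ℝ =>
        t * (P {ω | (ENNReal.ofReal (X ω / t), ENNReal.ofReal (Y ω / t)) ∈ S}).toReal)
      atTop (𝓝 (μ S).toReal)

/-- The rectangle `[0,x] × (y,∞]`. -/
def rectNb (x y : ℝ) : Set Epts := Set.Iic (ENNReal.ofReal x) ×ˢ Set.Ioi (ENNReal.ofReal y)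

/-- The rectangle `(x,∞] × [0,y]`. -/
def rectNl (x y : ℝ) : Set Epts := Set.Ioi (ENNReal.ofReal x) ×ˢ Set.Iic (ENNReal.ofReal y)

/-- Conditional non-degeneracy conditions on `E⊓`. -/
def NondegNb (μ : Measure Epts) : Prop :=
  (∀ x y : ℝ, 0 ≤ x → 0 < y → μ (rectNb x y) ≠ ⊤) ∧
  (∀ y : ℝ, 0 < y → ∃ x₁ x₂ : ℝ, 0 ≤ x₁ ∧ 0 ≤ x₂ ∧ μ (rectNb x₁ y) ≠ μ (rectNb x₂ y))

/-- Conditional non-degeneracy conditions on `E⊃`. -/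
def NondegNl (ν : Measure Epts) : Prop :=
  (∀ x y : ℝ, 0 < x → 0 ≤ y → ν (rectNl x y) ≠ ⊤) ∧
  (∀ x : ℝ, 0 < x → ∃ y₁ y₂ : ℝ, 0 ≤ y₁ ∧ 0 ≤ y₂ ∧ ν (rectNl x y₁) ≠ ν (rectNl x y₂))

/-- The angular coordinate `x/(x+y)` on `[0,∞]²` (equal to `1` when `x = ∞`). -/
def ang (p : Epts) : ℝ := if p.1 = ⊤ then 1 else (p.1 / (p.1 + p.2)).toReal

/-- `μ` is homogeneous of order `-1`: `μ(cB) = c⁻¹ μ(B)` for all `c > 0`. -/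
def HomogMinusOne (μ : Measure Epts) : Prop :=
  ∀ c : ℝ, 0 < c → ∀ B : Set Epts, MeasurableSet B →
    μ ((fun p : Epts => (ENNReal.ofReal c * p.1, ENNReal.ofReal c * p.2)) '' B) =
      (ENNReal.ofReal c)⁻¹ * μ B

theorem aux_meas_ang : Measurable ang := by
  unfold ang
  refine Measurable.ite (measurable_fst (measurableSet_singleton _)) measurable_const ?_
  exact (measurable_fst.div (measurable_fst.add measurable_snd)).ennreal_toReal

theorem aux_ang_scale (c : ℝ≥0∞) (hc : c ≠ 0) (hc' : c ≠ ⊤) (p : Epts) :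
    ang (c * p.1, c * p.2) = ang p := by
  unfold ang
  by_cases h : p.1 = ⊤
  · simp [h, ENNReal.mul_top hc]
  · have : c * p.1 ≠ ⊤ := ENNReal.mul_ne_top hc' h
    simp only [h, this, if_false]
    rw [← mul_add, ENNReal.mul_div_mul_left _ _ hc hc']

theorem aux_polar (μ : Measure Epts) (hhom : HomogMinusOne μ) (S : Measure ℝ)
    (hS : ∀ Λ : Set ℝ, MeasurableSet Λ →
      S Λ = μ {p : Epts | 1 < p.1 + p.2 ∧ ang p ∈ Λ})
    (r : ℝ) (hr : 0 < r) (Λ : Set ℝ) (hΛ : MeasurableSet Λ) :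
    μ {p : Epts | ENNReal.ofReal r < p.1 + p.2 ∧ ang p ∈ Λ} =
        (ENNReal.ofReal r)⁻¹ * S Λ := by
  have hB : MeasurableSet {p : Epts | 1 < p.1 + p.2 ∧ ang p ∈ Λ} :=
    (measurableSet_lt measurable_const (measurable_fst.add measurable_snd)).inter
      (aux_meas_ang hΛ)
  rw [hS Λ hΛ, ← hhom r hr _ hB]
  congr 1
  have hc : ENNReal.ofReal r ≠ 0 := by simpa using hr
  have hc' : ENNReal.ofReal r ≠ ⊤ := ENNReal.ofReal_ne_top
  generalize ENNReal.ofReal r = c at *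
  ext p
  simp only [mem_ofPred_eq, mem_image]
  constructor
  · rintro ⟨h1, h2⟩
    have e : ∀ t : ℝ≥0∞, c * (c⁻¹ * t) = t := fun t => by
      rw [← mul_assoc, ENNReal.mul_inv_cancel hc hc', one_mul]
    refine ⟨(c⁻¹ * p.1, c⁻¹ * p.2), ⟨?_, ?_⟩, by simp [e]⟩
    · simp only [← mul_add]
      rw [← ENNReal.mul_lt_mul_iff_right hc hc', e, mul_one]
      exact h1
    · rw [aux_ang_scale _ (by simpa using hc') (by simpa using hc)]
      exact h2
  · rintro ⟨q, ⟨h1, h2⟩, rfl⟩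
    refine ⟨?_, ?_⟩
    · simp only [← mul_add]
      conv_lhs => rw [← mul_one c]
      exact (ENNReal.mul_lt_mul_iff_right hc hc').2 h1
    · rw [aux_ang_scale _ hc hc']
      exact h2

theorem aux_simple (μ : Measure Epts) (S : Measure ℝ)
    (hp : ∀ r : ℝ, 0 < r → ∀ Λ : Set ℝ, MeasurableSet Λ →
      μ {p : Epts | ENNReal.ofReal r < p.1 + p.2 ∧ ang p ∈ Λ} =
        (ENNReal.ofReal r)⁻¹ * S Λ)
    (f : SimpleFunc ℝ ℝ≥0∞) (hf : ∀ w, f w < ⊤) :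
    μ {p : Epts | 1 < (p.1 + p.2) * f (ang p)} = f.lintegral S := by
  have hm : ∀ c : ℝ≥0∞, MeasurableSet {p : Epts | 1 < (p.1 + p.2) * c ∧ ang p ∈ f ⁻¹' {c}} :=
    fun c => (measurableSet_lt measurable_const
      ((measurable_fst.add measurable_snd).mul_const c)).inter
      (aux_meas_ang (f.measurableSet_preimage _))
  have h1 : {p : Epts | 1 < (p.1 + p.2) * f (ang p)} =
      ⋃ c ∈ f.range, {p : Epts | 1 < (p.1 + p.2) * c ∧ ang p ∈ f ⁻¹' {c}} := by
    ext p
    simp only [mem_ofPred_eq, mem_iUnion, mem_preimage, mem_singleton_iff, exists_prop]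
    constructor
    · intro h
      exact ⟨f (ang p), f.mem_range_self _, h, rfl⟩
    · rintro ⟨c, _, h, rfl⟩
      exact h
  rw [h1, measure_biUnion_finset ?_ (fun c _ => hm c), SimpleFunc.lintegral]
  · refine Finset.sum_congr rfl fun c hc => ?_
    rcases eq_or_ne c 0 with rfl | h0
    · simp
    · obtain ⟨w, rfl⟩ := SimpleFunc.mem_range.1 hc
      have hw := hf w
      generalize f w = c at *
      have hr : 0 < (c⁻¹).toReal := ENNReal.toReal_pos (by simpa using hw.ne) (by simpa using h0)
      have h2 := hp _ hr (f ⁻¹' {c}) (f.measurableSet_preimage _)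
      rw [ENNReal.ofReal_toReal (by simpa using h0), inv_inv] at h2
      rw [← h2]
      congr 1
      ext p
      simp only [mem_ofPred_eq]
      rw [← one_div, ENNReal.div_lt_iff (Or.inl h0) (Or.inl hw.ne)]
  · intro c _ d _ hcd
    refine Set.disjoint_left.2 ?_
    rintro p ⟨_, h⟩ ⟨_, h'⟩
    exact hcd ((show f (ang p) = c from h).symm.trans h')

theorem aux_lint (μ : Measure Epts) (S : Measure ℝ)
    (hp : ∀ r : ℝ, 0 < r → ∀ Λ : Set ℝ, MeasurableSet Λ →
      μ {p : Epts | ENNReal.ofReal r < p.1 + p.2 ∧ ang p ∈ Λ} =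
        (ENNReal.ofReal r)⁻¹ * S Λ)
    (g : ℝ → ℝ≥0∞) (hg : Measurable g) :
    μ {p : Epts | 1 < (p.1 + p.2) * g (ang p)} = ∫⁻ w, g w ∂S := by
  have h1 : {p : Epts | 1 < (p.1 + p.2) * g (ang p)} =
      ⋃ n : ℕ, {p : Epts | 1 < (p.1 + p.2) * SimpleFunc.eapprox g n (ang p)} := by
    ext p
    simp only [mem_ofPred_eq, mem_iUnion]
    rw [← SimpleFunc.iSup_eapprox_apply hg, ENNReal.mul_iSup, lt_iSup_iff]
  rw [h1, Monotone.measure_iUnion, lintegral_eq_iSup_eapprox_lintegral hg]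
  · refine iSup_congr fun n => ?_
    exact aux_simple μ S hp _ (fun w => SimpleFunc.eapprox_lt_top g n w)
  · intro m n hmn p h
    have h' : 1 < (p.1 + p.2) * SimpleFunc.eapprox g m (ang p) := h
    show 1 < (p.1 + p.2) * SimpleFunc.eapprox g n (ang p)
    refine lt_of_lt_of_le h' ?_
    exact mul_le_mul_right (SimpleFunc.monotone_eapprox g hmn _) _

theorem aux_null (μ : Measure Epts)
    (hRadon : ∀ A : Set Epts, closure A ⊆ Enb → μ A ≠ ⊤)
    (hhom : HomogMinusOne μ) : ∀ᵐ p ∂μ, p.2 ≠ ⊤ := by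
  have hcl : IsClosed {p : Epts | p.2 = ⊤} := isClosed_eq continuous_snd continuous_const
  have hfin : μ {p : Epts | p.2 = ⊤} ≠ ⊤ := by
    refine hRadon _ ?_
    rw [hcl.closure_eq]
    rintro p hp
    refine ⟨mem_univ _, ?_⟩
    rw [mem_ofPred_eq] at hp
    simp [hp]
  have h := hhom 2 two_pos _ hcl.measurableSet
  have h2 : (fun p : Epts => (ENNReal.ofReal 2 * p.1, ENNReal.ofReal 2 * p.2)) ''
      {p : Epts | p.2 = ⊤} = {p : Epts | p.2 = ⊤} := by
    have e : ENNReal.ofReal 2 = 2 := by simp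
    rw [e]
    ext p
    simp only [mem_image, mem_ofPred_eq]
    constructor
    · rintro ⟨q, hq, rfl⟩
      simp [hq, ENNReal.mul_top]
    · intro hq
      refine ⟨(2⁻¹ * p.1, ⊤), rfl, ?_⟩
      ext1
      · simp [← mul_assoc, ENNReal.mul_inv_cancel]
      · simp [hq, ENNReal.mul_top]
  rw [h2] at h
  rw [ae_iff]
  simp only [ne_eq, not_not]
  have h3 := congrArg ENNReal.toReal h
  rw [ENNReal.toReal_mul] at h3
  have h4 : (μ {p : Epts | p.2 = ⊤}).toReal = 0 := by
    norm_num at h3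
    linarith
  rcases (ENNReal.toReal_eq_zero_iff _).1 h4 with h5 | h5
  · exact h5
  · exact absurd h5 hfin

theorem aux_ang_real (a b : ℝ≥0) : ang ((a : ℝ≥0∞), (b : ℝ≥0∞)) = (a : ℝ) / (a + b) := by
  simp [ang, ENNReal.toReal_div, ENNReal.toReal_add]

theorem aux_pt1 (x y : ℝ) (hx : 0 < x) (hy : 0 < y) (a b : ℝ≥0) :
    1 < ((a : ℝ≥0∞) + b) * (Ico 0 (x / (x + y))).indicator
      (fun w => ENNReal.ofReal y⁻¹ * ENNReal.ofReal (1 - w)) (ang (a, b)) ↔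
    y < b ∧ (a : ℝ) * y < b * x := by
  have ha := a.coe_nonneg
  have hb := b.coe_nonneg
  rw [aux_ang_real]
  by_cases h0 : (a : ℝ) + b = 0
  · have hb0 : (b : ℝ) = 0 := by linarith
    have ha0 : (a : ℝ) = 0 := by linarith
    have hb1 : b = 0 := by exact_mod_cast hb0
    have ha1 : a = 0 := by exact_mod_cast ha0
    simp [ha1, hb1, hy.le]
  have hpos : 0 < (a : ℝ) + b := lt_of_le_of_ne (by positivity) (Ne.symm h0)
  have hiff : (a : ℝ) / (a + b) ∈ Ico 0 (x / (x + y)) ↔ (a : ℝ) * y < b * x := by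
    rw [mem_Ico, div_lt_div_iff₀ hpos (by positivity)]
    constructor
    · rintro ⟨_, h⟩; linarith
    · intro h; exact ⟨by positivity, by linarith⟩
  by_cases hm : (a : ℝ) * y < b * x
  · rw [indicator_of_mem (hiff.2 hm)]
    have e : (a : ℝ≥0∞) + b = ENNReal.ofReal ((a : ℝ) + b) := by
      rw [ENNReal.ofReal_add ha hb]; simp
    rw [e, ← ENNReal.ofReal_mul (by positivity), ← ENNReal.ofReal_mul (by positivity),
      ENNReal.one_lt_ofReal]
    have e2 : ((a : ℝ) + b) * (y⁻¹ * (1 - a / (a + b))) = b / y := by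
      field_simp
      ring
    rw [e2, one_lt_div hy]
    exact ⟨fun h => ⟨h, hm⟩, fun h => h.1⟩
  · rw [indicator_of_notMem (fun h => hm (hiff.1 h))]
    simp [hm]

theorem aux_pt2 (x y : ℝ) (hx : 0 < x) (hy : 0 < y) (a b : ℝ≥0) :
    1 < ((a : ℝ≥0∞) + b) * (Ico 0 (x / (x + y))).indicator
      (fun w => ENNReal.ofReal x⁻¹ * ENNReal.ofReal w) (ang (a, b)) ↔
    x < a ∧ (a : ℝ) * y < b * x := by
  have ha := a.coe_nonneg
  have hb := b.coe_nonneg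
  rw [aux_ang_real]
  by_cases h0 : (a : ℝ) + b = 0
  · have hb0 : (b : ℝ) = 0 := by linarith
    have ha0 : (a : ℝ) = 0 := by linarith
    have hb1 : b = 0 := by exact_mod_cast hb0
    have ha1 : a = 0 := by exact_mod_cast ha0
    simp [ha1, hb1]
  have hpos : 0 < (a : ℝ) + b := lt_of_le_of_ne (by positivity) (Ne.symm h0)
  have hiff : (a : ℝ) / (a + b) ∈ Ico 0 (x / (x + y)) ↔ (a : ℝ) * y < b * x := by
    rw [mem_Ico, div_lt_div_iff₀ hpos (by positivity)]
    constructor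
    · rintro ⟨_, h⟩; linarith
    · intro h; exact ⟨by positivity, by linarith⟩
  by_cases hm : (a : ℝ) * y < b * x
  · rw [indicator_of_mem (hiff.2 hm)]
    have e : (a : ℝ≥0∞) + b = ENNReal.ofReal ((a : ℝ) + b) := by
      rw [ENNReal.ofReal_add ha hb]; simp
    rw [e, ← ENNReal.ofReal_mul (by positivity), ← ENNReal.ofReal_mul (by positivity),
      ENNReal.one_lt_ofReal]
    have e2 : ((a : ℝ) + b) * (x⁻¹ * (a / (a + b))) = a / x := by
      field_simp
    rw [e2, one_lt_div hx]
    exact ⟨fun h => ⟨h, hm⟩, fun h => h.1⟩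
  · rw [indicator_of_notMem (fun h => hm (hiff.1 h))]
    simp [hm]

theorem aux_ptrect (x y : ℝ) (hx : 0 < x) (hy : 0 < y) (a b : ℝ≥0) :
    ((a : ℝ≥0∞), (b : ℝ≥0∞)) ∈ rectNb x y ↔ (a : ℝ) ≤ x ∧ y < b := by
  have h1 : (a : ℝ≥0∞) = ENNReal.ofReal a := by simp
  have h2 : (b : ℝ≥0∞) = ENNReal.ofReal b := by simp
  rw [h1, h2]
  simp only [rectNb, mem_prod, mem_Iic, mem_Ioi]
  rw [ENNReal.ofReal_le_ofReal_iff hx.le, ENNReal.ofReal_lt_ofReal_iff_of_nonneg hy.le]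

theorem aux_top (x y : ℝ) (hx : 0 < x) (hy : 0 < y) (h : ℝ → ℝ≥0∞) (b : ℝ≥0∞) :
    (Ico 0 (x / (x + y))).indicator h (ang (⊤, b)) = 0 := by
  refine indicator_of_notMem ?_ _
  have : x / (x + y) < 1 := by rw [div_lt_one (by positivity)]; linarith
  simp [ang, this.le]

/-- **Spectral decomposition on `E⊓`**: for a Radon measure `μ**` on
`E⊓ = [0,∞]×(0,∞]` homogeneous of order `-1`, with angular measure
`S(Λ) = μ**{x+y > 1, x/(x+y) ∈ Λ}` on `[0,1)`, one has
`μ**{x+y > r, x/(x+y) ∈ Λ} = r⁻¹ S(Λ)` and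
`μ**([0,x]×(y,∞]) = y⁻¹∫₀^{x/(x+y)}(1-w) S(dw) - x⁻¹∫₀^{x/(x+y)} w S(dw)`. -/
theorem spectral_form_on_Enb
    (μ : Measure Epts)
    (hsupp : μ Enbᶜ = 0)
    (hRadon : ∀ A : Set Epts, closure A ⊆ Enb → μ A ≠ ⊤)
    (hhom : HomogMinusOne μ)
    (S : Measure ℝ)
    (hS : ∀ Λ : Set ℝ, MeasurableSet Λ →
      S Λ = μ {p : Epts | 1 < p.1 + p.2 ∧ ang p ∈ Λ}) :
    -- (1) the polar decomposition:
    (∀ r : ℝ, 0 < r → ∀ Λ : Set ℝ, MeasurableSet Λ → Λ ⊆ Set.Ico 0 1 →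
      μ {p : Epts | ENNReal.ofReal r < p.1 + p.2 ∧ ang p ∈ Λ} =
        (ENNReal.ofReal r)⁻¹ * S Λ) ∧
    -- (2) the rectangle formula:
    (∀ x y : ℝ, 0 < x → 0 < y →
      (μ (rectNb x y)).toReal =
        y⁻¹ * (∫⁻ w in Set.Ico (0 : ℝ) (x / (x + y)), ENNReal.ofReal (1 - w) ∂S).toReal -
        x⁻¹ * (∫⁻ w in Set.Ico (0 : ℝ) (x / (x + y)), ENNReal.ofReal w ∂S).toReal) := by
  have hp := aux_polar μ hhom S hS
  refine ⟨fun r hr Λ hΛ _ => hp r hr Λ hΛ, fun x y hx hy => ?_⟩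
  have hnull := aux_null μ hRadon hhom
  set T := Ico (0 : ℝ) (x / (x + y)) with hT
  have hTm : MeasurableSet T := measurableSet_Ico
  have m1 : Measurable fun w : ℝ => ENNReal.ofReal (1 - w) := by fun_prop
  have m2 : Measurable fun w : ℝ => ENNReal.ofReal w := by fun_prop
  have g1 : Measurable (T.indicator fun w => ENNReal.ofReal y⁻¹ * ENNReal.ofReal (1 - w)) :=
    (m1.const_mul _).indicator hTm
  have g2 : Measurable (T.indicator fun w => ENNReal.ofReal x⁻¹ * ENNReal.ofReal w) :=
    (m2.const_mul _).indicator hTm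
  have i1 := aux_lint μ S hp _ g1
  have i2 := aux_lint μ S hp _ g2
  rw [lintegral_indicator hTm, lintegral_const_mul _ m1] at i1
  rw [lintegral_indicator hTm, lintegral_const_mul _ m2] at i2
  set A := {p : Epts | 1 < (p.1 + p.2) *
    T.indicator (fun w => ENNReal.ofReal y⁻¹ * ENNReal.ofReal (1 - w)) (ang p)} with hA
  set B := {p : Epts | 1 < (p.1 + p.2) *
    T.indicator (fun w => ENNReal.ofReal x⁻¹ * ENNReal.ofReal w) (ang p)} with hB
  have hBm : MeasurableSet B := measurableSet_lt measurable_const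
    ((measurable_fst.add measurable_snd).mul (g2.comp aux_meas_ang))
  have key : ∀ p : Epts, p.2 ≠ ⊤ → (p ∈ rectNb x y ↔ p ∈ A ∧ p ∉ B) ∧ (p ∈ B → p ∈ A) ∧
      (p ∈ A → p ∈ {p : Epts | ENNReal.ofReal y ≤ p.2}) := by
    rintro ⟨u, v⟩ hv
    lift v to ℝ≥0 using hv
    rcases eq_or_ne u ⊤ with rfl | hu
    · simp only [hA, hB, mem_ofPred_eq, hT, aux_top x y hx hy]
      simp [rectNb]
    · lift u to ℝ≥0 using hu
      have hu := u.coe_nonneg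
      have e1 : ((u : ℝ≥0∞), (v : ℝ≥0∞)) ∈ A ↔ _ := aux_pt1 x y hx hy u v
      have e2 : ((u : ℝ≥0∞), (v : ℝ≥0∞)) ∈ B ↔ _ := aux_pt2 x y hx hy u v
      rw [e1, e2, aux_ptrect x y hx hy]
      refine ⟨⟨?_, ?_⟩, ?_, ?_⟩
      · rintro ⟨h1, h2⟩
        exact ⟨⟨h2, by nlinarith⟩, fun h => by linarith [h.1]⟩
      · rintro ⟨⟨h1, h2⟩, h3⟩
        exact ⟨not_lt.1 fun h => h3 ⟨h, h2⟩, h1⟩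
      · rintro ⟨h1, h2⟩
        exact ⟨by by_contra! h; nlinarith, h2⟩
      · rintro ⟨h1, h2⟩
        simp only [mem_ofPred_eq]
        exact ENNReal.ofReal_le_of_le_toReal (by simpa using h1.le)
  have hAfin : μ A ≠ ⊤ := by
    have hc : IsClosed {p : Epts | ENNReal.ofReal y ≤ p.2} :=
      isClosed_le continuous_const continuous_snd
    have hf : μ {p : Epts | ENNReal.ofReal y ≤ p.2} ≠ ⊤ := by
      refine hRadon _ ?_
      rw [hc.closure_eq]
      intro p hp
      exact ⟨mem_univ _, lt_of_lt_of_le (ENNReal.ofReal_pos.2 hy) hp⟩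
    refine ne_top_of_le_ne_top hf (measure_mono_ae ?_)
    filter_upwards [hnull] with p hp
    exact (key p hp).2.2
  have hBA : B ≤ᵐ[μ] A := by
    filter_upwards [hnull] with p hp
    exact (key p hp).2.1
  have hrect : μ (rectNb x y) = μ A - μ B := by
    have hd : μ (A ∩ B) + μ (A \ B) = μ A := measure_inter_add_diff A hBm
    have hAB : μ (A ∩ B) = μ B := by
      refine measure_congr ?_
      filter_upwards [hnull] with p hp
      exact propext ⟨fun h => h.2, fun h => ⟨(key p hp).2.1 h, h⟩⟩
    rw [hAB, add_comm] at hd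
    rw [← ENNReal.eq_sub_of_add_eq (ne_top_of_le_ne_top hAfin (measure_mono_ae hBA)) hd]
    refine measure_congr ?_
    filter_upwards [hnull] with p hp
    exact propext (key p hp).1
  rw [hrect, ENNReal.toReal_sub_of_le (measure_mono_ae hBA) hAfin, i1, i2, ENNReal.toReal_mul,
    ENNReal.toReal_mul, ENNReal.toReal_ofReal (by positivity), ENNReal.toReal_ofReal (by positivity)]
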